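/- Let A > 0, λ ≥ 0, and let μ be a probability measure supported in [0,A] with μ((0,A]) > 0 or λ > 0, so that m_y := ∫ (x+λ)^y e^{-(x+λ)} dμ(x) > 0 for all y ∈ ℕ. Let i(x; μ) = D(P_{Y|X}(·|x) ‖ P_Y^μ) be the relative entropy between the Poisson transition pmf at input x and the output pmf P_Y^μ(y) = m_y/y!. Then for every x > 0, i(·;μ) is twice differentiable at x and i''(x; μ) = Σ_{y=0}^∞ P_{Y|X}(y|x) · log((x+λ) · m_{y+1} / m_{y+2}) − i'(x; μ) + 1/(x+λ). -/

import Mathlib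

open MeasureTheory Real Set

noncomputable section

/-- Poisson transition pmf with dark current `lam`:
`P_{Y|X}(y|x) = (x+lam)^y e^{-(x+lam)} / y!` (with the convention `0^0 = 1`). -/
def channelPMF (lam x : ℝ) (y : ℕ) : ℝ :=
  (x + lam) ^ y * Real.exp (-(x + lam)) / (Nat.factorial y)

/-- `m_y = ∫ (x+lam)^y e^{-(x+lam)} dμ(x)`, so the output pmf is `P_Y(y) = m_y / y!`. -/
def mom (lam : ℝ) (μ : Measure ℝ) (y : ℕ) : ℝ :=
  ∫ x, (x + lam) ^ y * Real.exp (-(x + lam)) ∂μ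

/-- `G(x) = Σ_y P_{Y|X}(y|x) log(1 / (y! P_Y(y)))` with `P_Y(y) = m_y / y!`. -/
def GFun (lam : ℝ) (μ : Measure ℝ) (x : ℝ) : ℝ :=
  ∑' y : ℕ, channelPMF lam x y *
    Real.log (1 / ((Nat.factorial y : ℝ) * (mom lam μ y / (Nat.factorial y : ℝ))))

/-- Kullback–Leibler divergence between pmfs on `ℕ` (natural logarithm). -/
def klDiv (p q : ℕ → ℝ) : ℝ :=
  ∑' y, p y * Real.log (p y / q y)

/-- `i(x; μ) = D(P_{Y|X}(·|x) ‖ P_Y^μ)` with `P_Y^μ(y) = m_y / y!`. -/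
def iFun (lam : ℝ) (μ : Measure ℝ) (x : ℝ) : ℝ :=
  klDiv (channelPMF lam x) (fun y => mom lam μ y / (Nat.factorial y : ℝ))

/-- Sequences growing at most like `2 ^ n`. -/
def GeomBounded (a : ℕ → ℝ) : Prop := ∃ C, ∀ n, |a n| ≤ C * 2 ^ n

lemma GeomBounded.shift {a : ℕ → ℝ} (ha : GeomBounded a) :
    GeomBounded fun n => a (n + 1) := by
  obtain ⟨C, hC⟩ := ha
  exact ⟨C * 2, fun n => (hC (n + 1)).trans_eq (by ring)⟩

lemma GeomBounded.sub {a b : ℕ → ℝ} (ha : GeomBounded a) (hb : GeomBounded b) :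
    GeomBounded fun n => a n - b n := by
  obtain ⟨C, hC⟩ := ha
  obtain ⟨D, hD⟩ := hb
  exact ⟨C + D, fun n => (abs_sub _ _).trans (by linarith [hC n, hD n])⟩

lemma geomBounded_of_affine {a : ℕ → ℝ} {C D : ℝ} (hC : 0 ≤ C) (hD : 0 ≤ D)
    (h : ∀ n : ℕ, |a n| ≤ C + D * n) : GeomBounded a := by
  refine ⟨C + D, fun n => (h n).trans ?_⟩
  have h1 : (1 : ℝ) ≤ 2 ^ n := one_le_pow₀ one_le_two
  have h2 : (n : ℝ) ≤ 2 ^ n := by exact_mod_cast Nat.lt_two_pow_self.le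
  nlinarith

lemma geomBounded_const (c : ℝ) : GeomBounded fun _ => c :=
  geomBounded_of_affine (abs_nonneg c) le_rfl fun n => by simp

lemma geomBounded_natCast : GeomBounded fun n => (n : ℝ) :=
  geomBounded_of_affine le_rfl zero_le_one fun n => by simp

lemma summable_pow_div_factorial_mul {a : ℕ → ℝ} (ha : GeomBounded a) (s : ℝ) :
    Summable fun n : ℕ => s ^ n / n.factorial * a n := by
  obtain ⟨C, hC⟩ := ha
  refine Summable.of_norm_bounded
    ((Real.summable_pow_div_factorial (2 * |s|)).mul_left C) fun n => ?_
  rw [norm_mul, norm_div, norm_pow, Real.norm_eq_abs, Real.norm_eq_abs, Real.norm_eq_abs,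
    Nat.abs_cast]
  calc |s| ^ n / n.factorial * |a n| ≤ |s| ^ n / n.factorial * (C * 2 ^ n) := by
        gcongr; exact hC n
    _ = C * ((2 * |s|) ^ n / n.factorial) := by rw [mul_pow]; ring

lemma hasDerivAt_tsum_pow_div_factorial_mul {a : ℕ → ℝ} (ha : GeomBounded a) (s : ℝ) :
    HasDerivAt (fun t : ℝ => ∑' n : ℕ, t ^ n / n.factorial * a n)
      (∑' n : ℕ, s ^ n / n.factorial * a (n + 1)) s := by
  set R := |s| + 1 with hR
  have hR0 : 0 < R := by positivity
  have hsucc (t : ℝ) (n : ℕ) :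
      ((n + 1 : ℕ) : ℝ) * t ^ (n + 1 - 1) / (n + 1).factorial * a (n + 1) =
        t ^ n / n.factorial * a (n + 1) := by
    rw [Nat.factorial_succ, Nat.add_sub_cancel]
    push_cast
    field_simp
  have hsum (t : ℝ) : Summable fun n : ℕ => (n : ℝ) * t ^ (n - 1) / n.factorial * a n := by
    rw [← summable_nat_add_iff 1]
    simp only [hsucc]
    exact summable_pow_div_factorial_mul ha.shift t
  have key := hasDerivAt_tsum_of_isPreconnected (hsum R).norm Metric.isOpen_ball
    (convex_ball (0 : ℝ) R).isPreconnected
    (g := fun (n : ℕ) (t : ℝ) => t ^ n / n.factorial * a n)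
    (g' := fun (n : ℕ) (t : ℝ) => (n : ℝ) * t ^ (n - 1) / n.factorial * a n)
    (fun n t _ => ((hasDerivAt_pow n t).div_const _).mul_const _)
    (fun n t ht => by
      have ht' : |t| ≤ |R| := by
        rw [abs_of_pos hR0, ← Real.norm_eq_abs]
        exact (mem_ball_zero_iff.1 ht).le
      simp only [norm_mul, norm_div, norm_pow, Real.norm_eq_abs]
      gcongr)
    (Metric.mem_ball_self hR0) (summable_pow_div_factorial_mul ha 0)
    (y := s) (by simp [hR])
  refine key.congr_deriv ?_
  rw [(hsum s).tsum_eq_zero_add]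
  simp only [hsucc]
  simp

lemma channelPMF_mul_eq (lam x : ℝ) (a : ℕ → ℝ) (n : ℕ) :
    channelPMF lam x n * a n =
      Real.exp (-(x + lam)) * ((x + lam) ^ n / n.factorial * a n) := by
  unfold channelPMF
  ring

lemma summable_channelPMF_mul {a : ℕ → ℝ} (ha : GeomBounded a) (lam x : ℝ) :
    Summable fun n => channelPMF lam x n * a n := by
  simp only [channelPMF_mul_eq]
  exact (summable_pow_div_factorial_mul ha _).mul_left _

lemma hasDerivAt_tsum_channelPMF_mul {a : ℕ → ℝ} (ha : GeomBounded a) (lam x : ℝ) :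
    HasDerivAt (fun t => ∑' n, channelPMF lam t n * a n)
      (∑' n, channelPMF lam x n * (a (n + 1) - a n)) x := by
  have h1 : HasDerivAt (fun t : ℝ => t + lam) 1 x := (hasDerivAt_id x).add_const lam
  have h2 := (hasDerivAt_tsum_pow_div_factorial_mul ha (x + lam)).comp x h1
  have h3 := h1.neg.exp.mul h2
  have hfun : (fun t => ∑' n, channelPMF lam t n * a n) = fun t =>
      Real.exp (-(t + lam)) * ∑' n : ℕ, (t + lam) ^ n / n.factorial * a n := by
    funext t
    simp only [channelPMF_mul_eq, tsum_mul_left]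
  rw [hfun]
  refine h3.congr_deriv ?_
  simp only [mul_sub]
  rw [(summable_channelPMF_mul ha.shift lam x).tsum_sub (summable_channelPMF_mul ha lam x)]
  simp only [channelPMF_mul_eq lam x a, channelPMF_mul_eq lam x fun n => a (n + 1), tsum_mul_left,
    Function.comp_apply, Pi.neg_apply]
  ring

lemma tsum_channelPMF (lam x : ℝ) : ∑' n, channelPMF lam x n = 1 := by
  have h (n : ℕ) : channelPMF lam x n =
      Real.exp (-(x + lam)) * ((x + lam) ^ n / n.factorial) := by
    unfold channelPMF
    ring
  simp only [h, tsum_mul_left]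
  rw [(NormedSpace.expSeries_div_hasSum_exp (x + lam)).tsum_eq, ← Real.exp_eq_exp_ℝ,
    ← Real.exp_add]
  simp

lemma tsum_channelPMF_mul_natCast (lam x : ℝ) :
    ∑' n : ℕ, channelPMF lam x n * n = x + lam := by
  rw [(summable_channelPMF_mul geomBounded_natCast lam x).tsum_eq_zero_add]
  have h (n : ℕ) : channelPMF lam x (n + 1) * ((n + 1 : ℕ) : ℝ) =
      (x + lam) * channelPMF lam x n := by
    unfold channelPMF
    rw [Nat.factorial_succ]
    push_cast
    field_simp
    ring
  simp only [h, tsum_mul_left, tsum_channelPMF]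
  simp

section Moments

variable {A lam : ℝ} {μ : Measure ℝ}

lemma ae_mem_Icc_of_compl (hsupp : μ (Set.Icc 0 A)ᶜ = 0) : ∀ᵐ x ∂μ, x ∈ Set.Icc 0 A :=
  mem_ae_iff.2 hsupp

lemma ae_mom_integrand_mem_Icc (hlam : 0 ≤ lam) (hsupp : μ (Set.Icc 0 A)ᶜ = 0) (y : ℕ) :
    ∀ᵐ x ∂μ, (x + lam) ^ y * Real.exp (-(x + lam)) ∈ Set.Icc 0 ((A + lam) ^ y) := by
  filter_upwards [ae_mem_Icc_of_compl hsupp] with x hx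
  have h0 : 0 ≤ x + lam := add_nonneg hx.1 hlam
  refine ⟨by positivity, ?_⟩
  calc (x + lam) ^ y * Real.exp (-(x + lam)) ≤ (A + lam) ^ y * 1 := by
        gcongr
        · exact pow_nonneg (h0.trans (by linarith [hx.2])) _
        · exact hx.2
        · exact Real.exp_le_one_iff.2 (by linarith)
    _ = _ := mul_one _

variable [IsProbabilityMeasure μ]

lemma integrable_mom_integrand (hlam : 0 ≤ lam) (hsupp : μ (Set.Icc 0 A)ᶜ = 0) (y : ℕ) :
    Integrable (fun x => (x + lam) ^ y * Real.exp (-(x + lam))) μ := by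
  refine Integrable.of_bound (by fun_prop) ((A + lam) ^ y) ?_
  filter_upwards [ae_mom_integrand_mem_Icc hlam hsupp y] with x hx
  rw [Real.norm_of_nonneg hx.1]
  exact hx.2

lemma mom_le (hlam : 0 ≤ lam) (hsupp : μ (Set.Icc 0 A)ᶜ = 0) (y : ℕ) :
    mom lam μ y ≤ (A + lam) ^ y := by
  have h := integral_mono_ae (integrable_mom_integrand hlam hsupp y)
    (integrable_const ((A + lam) ^ y))
    ((ae_mom_integrand_mem_Icc hlam hsupp y).mono fun x hx => hx.2)
  simpa [mom] using h

lemma exists_pos_measure_le_add (hlam : 0 ≤ lam) (hsupp : μ (Set.Icc 0 A)ᶜ = 0)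
    (hpos : 0 < μ (Set.Ioc 0 A) ∨ 0 < lam) :
    ∃ δ > 0, 0 < μ {x | δ ≤ x + lam} := by
  have hunion : (⋃ n : ℕ, {x : ℝ | 1 / ((n : ℝ) + 1) ≤ x + lam}) = {x | 0 < x + lam} := by
    ext x
    simp only [mem_iUnion, mem_ofPred_eq]
    refine ⟨fun ⟨n, hn⟩ => lt_of_lt_of_le (by positivity) hn, fun hx => ?_⟩
    obtain ⟨n, hn⟩ := exists_nat_one_div_lt hx
    exact ⟨n, hn.le⟩
  have hμ : μ {x | 0 < x + lam} ≠ 0 := by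
    rcases hpos with h | h
    · refine (h.trans_le (measure_mono fun x hx => ?_)).ne'
      exact add_pos_of_pos_of_nonneg hx.1 hlam
    · have : ∀ᵐ x ∂μ, 0 < x + lam := by
        filter_upwards [ae_mem_Icc_of_compl hsupp] with x hx
        exact add_pos_of_nonneg_of_pos hx.1 h
      rw [measure_congr (Filter.eventuallyEq_univ.2 this), measure_univ]
      exact one_ne_zero
  rw [← hunion, Ne, measure_iUnion_null_iff, not_forall] at hμ
  obtain ⟨n, hn⟩ := hμ
  exact ⟨1 / ((n : ℝ) + 1), by positivity, pos_iff_ne_zero.2 hn⟩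

lemma exists_mul_pow_le_mom (hlam : 0 ≤ lam) (hsupp : μ (Set.Icc 0 A)ᶜ = 0)
    (hpos : 0 < μ (Set.Ioc 0 A) ∨ 0 < lam) :
    ∃ c > 0, ∃ δ > 0, ∀ y, c * δ ^ y ≤ mom lam μ y := by
  obtain ⟨δ, hδ, hμ⟩ := exists_pos_measure_le_add hlam hsupp hpos
  refine ⟨Real.exp (-(A + lam)) * μ.real {x | δ ≤ x + lam},
    mul_pos (Real.exp_pos _) (ENNReal.toReal_pos hμ.ne' (measure_ne_top _ _)), δ, hδ, fun y => ?_⟩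
  have hmarkov := mul_meas_ge_le_integral_of_nonneg
    ((ae_mom_integrand_mem_Icc hlam hsupp y).mono fun x hx => hx.1)
    (integrable_mom_integrand hlam hsupp y) (δ ^ y * Real.exp (-(A + lam)))
  have hle : μ.real {x | δ ≤ x + lam} ≤ μ.real
      {x | δ ^ y * Real.exp (-(A + lam)) ≤ (x + lam) ^ y * Real.exp (-(x + lam))} := by
    refine ENNReal.toReal_mono (measure_ne_top _ _) (measure_mono_ae ?_)
    filter_upwards [ae_mem_Icc_of_compl hsupp] with x hx hδx
    have hδx' : δ ≤ x + lam := hδx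
    have hxA := hx.2
    change δ ^ y * Real.exp (-(A + lam)) ≤ (x + lam) ^ y * Real.exp (-(x + lam))
    gcongr
    exact pow_nonneg (hδ.le.trans hδx') _
  refine le_trans ?_ hmarkov
  calc Real.exp (-(A + lam)) * μ.real {x | δ ≤ x + lam} * δ ^ y
      = δ ^ y * Real.exp (-(A + lam)) * μ.real {x | δ ≤ x + lam} := by ring
    _ ≤ _ := by gcongr

lemma mom_pos (hlam : 0 ≤ lam) (hsupp : μ (Set.Icc 0 A)ᶜ = 0)
    (hpos : 0 < μ (Set.Ioc 0 A) ∨ 0 < lam) (y : ℕ) : 0 < mom lam μ y := by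
  obtain ⟨c, hc, δ, hδ, h⟩ := exists_mul_pow_le_mom hlam hsupp hpos
  exact lt_of_lt_of_le (by positivity) (h y)

lemma geomBounded_log_mom (hlam : 0 ≤ lam) (hsupp : μ (Set.Icc 0 A)ᶜ = 0)
    (hpos : 0 < μ (Set.Ioc 0 A) ∨ 0 < lam) :
    GeomBounded fun y => Real.log (mom lam μ y) := by
  obtain ⟨c, hc, δ, hδ, h⟩ := exists_mul_pow_le_mom hlam hsupp hpos
  refine geomBounded_of_affine (C := |Real.log c|) (D := |Real.log δ| + |Real.log (A + lam)|)
    (by positivity) (by positivity) fun y => ?_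
  have hlow := Real.log_le_log (by positivity) (h y)
  have hupp := Real.log_le_log (mom_pos hlam hsupp hpos y) (mom_le hlam hsupp y)
  rw [Real.log_mul hc.ne' (by positivity), Real.log_pow] at hlow
  rw [Real.log_pow] at hupp
  have hy : (0 : ℝ) ≤ y := Nat.cast_nonneg y
  have h1 := mul_le_mul_of_nonneg_left (neg_abs_le (Real.log δ)) hy
  have h2 := mul_le_mul_of_nonneg_left (le_abs_self (Real.log (A + lam))) hy
  have h3 : 0 ≤ (y : ℝ) * |Real.log δ| := by positivity
  have h4 : 0 ≤ (y : ℝ) * |Real.log (A + lam)| := by positivity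
  rw [abs_le]
  constructor <;> linarith [neg_abs_le (Real.log c), abs_nonneg (Real.log c)]

end Moments

lemma iFun_eq {lam x : ℝ} {μ : Measure ℝ} (hm : ∀ y, 0 < mom lam μ y)
    (hlog : GeomBounded fun y => Real.log (mom lam μ y)) (hs : 0 < x + lam) :
    iFun lam μ x = (x + lam) * Real.log (x + lam) - (x + lam) -
      ∑' y, channelPMF lam x y * Real.log (mom lam μ y) := by
  have hterm (y : ℕ) : channelPMF lam x y *
      Real.log (channelPMF lam x y / (mom lam μ y / (Nat.factorial y : ℝ))) =
        channelPMF lam x y * y * Real.log (x + lam) - channelPMF lam x y * (x + lam) -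
          channelPMF lam x y * Real.log (mom lam μ y) := by
    have hquot : channelPMF lam x y / (mom lam μ y / (Nat.factorial y : ℝ)) =
        (x + lam) ^ y * Real.exp (-(x + lam)) / mom lam μ y := by
      have := (hm y).ne'
      unfold channelPMF
      field_simp
    rw [hquot, Real.log_div (by positivity) (hm y).ne', Real.log_mul (by positivity)
      (Real.exp_ne_zero _), Real.log_pow, Real.log_exp]
    ring
  have h1 := (summable_channelPMF_mul geomBounded_natCast lam x).mul_right (Real.log (x + lam))
  have h2 := summable_channelPMF_mul (geomBounded_const (x + lam)) lam x
  unfold iFun klDiv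
  simp only [hterm]
  rw [(h1.sub h2).tsum_sub (summable_channelPMF_mul hlog lam x), h1.tsum_sub h2,
    tsum_mul_right, tsum_mul_right, tsum_channelPMF_mul_natCast, tsum_channelPMF, one_mul]

lemma hasDerivAt_iFun {lam x : ℝ} {μ : Measure ℝ} (hm : ∀ y, 0 < mom lam μ y)
    (hlog : GeomBounded fun y => Real.log (mom lam μ y)) (hs : 0 < x + lam) :
    HasDerivAt (iFun lam μ) (Real.log (x + lam) -
      ∑' y, channelPMF lam x y * (Real.log (mom lam μ (y + 1)) - Real.log (mom lam μ y))) x := by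
  have h1 : HasDerivAt (fun t : ℝ => t + lam) 1 x := (hasDerivAt_id x).add_const lam
  have h2 := ((h1.mul (h1.log hs.ne')).sub h1).sub (hasDerivAt_tsum_channelPMF_mul hlog lam x)
  have hev : ∀ᶠ t in nhds x, 0 < t + lam := h1.continuousAt.eventually_const_lt hs
  refine (h2.congr_of_eventuallyEq (hev.mono fun t ht => iFun_eq hm hlog ht)).congr_deriv ?_
  field_simp
  ring

/-- Second derivative identity for `i(·; μ)`. -/
theorem iFun_second_deriv (A lam : ℝ) (hA : 0 < A) (hlam : 0 ≤ lam)
    (μ : Measure ℝ) [IsProbabilityMeasure μ] (hsupp : μ (Set.Icc 0 A)ᶜ = 0)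
    (hpos : 0 < μ (Set.Ioc 0 A) ∨ 0 < lam)
    (x : ℝ) (hx : 0 < x) :
    DifferentiableAt ℝ (iFun lam μ) x ∧
      HasDerivAt (deriv (iFun lam μ))
        ((∑' y : ℕ, channelPMF lam x y *
            Real.log ((x + lam) * mom lam μ (y + 1) / mom lam μ (y + 2)))
          - deriv (iFun lam μ) x + 1 / (x + lam)) x := by
  have hm := mom_pos hlam hsupp hpos
  have hlog := geomBounded_log_mom hlam hsupp hpos
  have hs : 0 < x + lam := by linarith
  have hderiv := hasDerivAt_iFun hm hlog hs
  refine ⟨hderiv.differentiableAt, ?_⟩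
  have h1 : HasDerivAt (fun t : ℝ => t + lam) 1 x := (hasDerivAt_id x).add_const lam
  have hev : ∀ᶠ t in nhds x, 0 < t + lam := h1.continuousAt.eventually_const_lt hs
  have hdiff := hlog.shift.sub hlog
  have h2 := (h1.log hs.ne').sub (hasDerivAt_tsum_channelPMF_mul hdiff lam x)
  refine (h2.congr_of_eventuallyEq
    (hev.mono fun t ht => (hasDerivAt_iFun hm hlog ht).deriv)).congr_deriv ?_
  have hterm (y : ℕ) : channelPMF lam x y *
      Real.log ((x + lam) * mom lam μ (y + 1) / mom lam μ (y + 2)) =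
        channelPMF lam x y * Real.log (x + lam) - channelPMF lam x y *
          (Real.log (mom lam μ (y + 1 + 1)) - Real.log (mom lam μ (y + 1))) := by
    rw [Real.log_div (mul_pos hs (hm _)).ne' (hm _).ne', Real.log_mul hs.ne' (hm _).ne']
    ring
  simp only [hterm]
  rw [hderiv.deriv,
    (summable_channelPMF_mul (geomBounded_const _) lam x).tsum_sub
      (summable_channelPMF_mul hdiff.shift lam x),
    tsum_mul_right, tsum_channelPMF]
  simp only [mul_sub (channelPMF lam x _) (_ - _)]
  rw [(summable_channelPMF_mul hdiff.shift lam x).tsum_sub (summable_channelPMF_mul hdiff lam x)]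
  ring
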